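/- Assume Setup (†). Then for all sufficiently large n, |L| ≤ ε^{1/3} n and W ⊆ L. -/

import Mathlib

open SimpleGraph

/-- The adjacency matrix of a simple graph over `ℝ`. -/
noncomputable def adjMat {V : Type*} [Fintype V] (G : SimpleGraph V) : Matrix V V ℝ :=
  letI := Classical.decRel G.Adj
  G.adjMatrix ℝ

/-- The spectral radius of a simple graph: the largest eigenvalue of its adjacency matrix. -/
noncomputable def specRad {V : Type*} [Fintype V] [DecidableEq V] (G : SimpleGraph V) : ℝ :=
  sSup (spectrum ℝ (adjMat G))

/-- The number of edges of a simple graph. -/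
noncomputable def eCnt {V : Type*} (G : SimpleGraph V) : ℕ := Nat.card G.edgeSet

/-- `G` contains a copy of `F` (a subgraph isomorphic to `F`). -/
def Contains {W V : Type*} (F : SimpleGraph W) (G : SimpleGraph V) : Prop :=
  ∃ f : F →g G, Function.Injective f

/-- `G` is `F`-free. -/
def FFree {W V : Type*} (F : SimpleGraph W) (G : SimpleGraph V) : Prop := ¬ Contains F G

/-- The Turán number `ex(n, F)`. -/
noncomputable def exNum {W : Type*} (n : ℕ) (F : SimpleGraph W) : ℕ :=
  sSup {m | ∃ G : SimpleGraph (Fin n), FFree F G ∧ eCnt G = m}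

/-- `G` is obtained from the Turán graph `T_{n,r}` by adding `a` edges. -/
def TuranPlus (n r a : ℕ) (G : SimpleGraph (Fin n)) : Prop :=
  (∃ H : SimpleGraph (Fin n), H ≤ G ∧ Nonempty (H ≃g turanGraph n r)) ∧
    eCnt G = eCnt (turanGraph n r) + a

/-- Hypothesis (★): for all sufficiently large `m`, `ex(m,F) = e(T_{m,r}) + a` and every
extremal graph is obtained from `T_{m,r}` by adding `a` edges. -/
def HypStar {W : Type*} (r a : ℕ) (F : SimpleGraph W) : Prop :=
  ∃ m₀ : ℕ, ∀ m ≥ m₀,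
    exNum m F = eCnt (turanGraph m r) + a ∧
    ∀ G : SimpleGraph (Fin m), FFree F G → eCnt G = exNum m F → TuranPlus m r a G

/-- `G` is a spectral-extremal `F`-free graph on its vertex set. -/
def SpecExtremal {W : Type*} (F : SimpleGraph W) {n : ℕ} (G : SimpleGraph (Fin n)) : Prop :=
  FFree F G ∧ ∀ G' : SimpleGraph (Fin n), FFree F G' → specRad G' ≤ specRad G

/-- Number of edges of `G` joining two distinct parts of the partition `p`. -/
noncomputable def crossCnt {n r : ℕ} (G : SimpleGraph (Fin n)) (p : Fin n → Fin r) : ℕ :=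
  Nat.card {e : Sym2 (Fin n) // e ∈ G.edgeSet ∧ ¬ (Sym2.map p e).IsDiag}

/-- Number of edges of `G` inside part `i` of the partition `p`, i.e. `e(G[Vᵢ])`. -/
noncomputable def inCnt {n r : ℕ} (G : SimpleGraph (Fin n)) (p : Fin n → Fin r)
    (i : Fin r) : ℕ :=
  Nat.card {e : Sym2 (Fin n) // e ∈ G.edgeSet ∧ Sym2.map p e = Sym2.diag i}

/-- The size of part `i` of the partition `p`, i.e. `|Vᵢ|`. -/
noncomputable def partSize {n r : ℕ} (p : Fin n → Fin r) (i : Fin r) : ℕ :=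
  Nat.card {v : Fin n // p v = i}

/-- The degree of `v` in `G`. -/
noncomputable def deg {n : ℕ} (G : SimpleGraph (Fin n)) (v : Fin n) : ℕ :=
  Nat.card (G.neighborSet v)

/-- `d_{Vᵢ}(v)`, the number of neighbours of `v` in part `i` of the partition `p`. -/
noncomputable def degIn {n r : ℕ} (G : SimpleGraph (Fin n)) (p : Fin n → Fin r)
    (i : Fin r) (v : Fin n) : ℕ :=
  Nat.card {w : Fin n // G.Adj v w ∧ p w = i}

/-- The partition `p` into `r` parts maximizes the number of edges between distinct parts,
`∑ eᵢ(Vᵢ) ≤ ε n²`, and each part has size strictly between `(1/r − 3√ε)n` and `(1/r + 3√ε)n`. -/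
def GoodPartition (r : ℕ) {n : ℕ} (G : SimpleGraph (Fin n)) (ε : ℝ)
    (p : Fin n → Fin r) : Prop :=
  (∀ q : Fin n → Fin r, crossCnt G q ≤ crossCnt G p) ∧
  (∑ i : Fin r, (inCnt G p i : ℝ)) ≤ ε * n ^ 2 ∧
  ∀ i : Fin r, (1 / (r : ℝ) - 3 * Real.sqrt ε) * n < partSize p i ∧
    (partSize p i : ℝ) < (1 / (r : ℝ) + 3 * Real.sqrt ε) * n

/-- The set `L` of low-degree vertices. -/
def Lset (r : ℕ) {n : ℕ} (G : SimpleGraph (Fin n)) (ε : ℝ) : Set (Fin n) :=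
  {v | (deg G v : ℝ) ≤ (1 - 1 / (r : ℝ) - 3 * r * ε ^ ((1 : ℝ) / 3)) * n}

/-- The set `W` of vertices with many neighbours inside their own part. -/
def Wset {n r : ℕ} (G : SimpleGraph (Fin n)) (p : Fin n → Fin r) (θ : ℝ) : Set (Fin n) :=
  {v | 2 * θ * n ≤ (degIn G p (p v) v : ℝ)}

open scoped Classical in
/-- The `0`-`1` indicator of adjacency. -/
noncomputable def adjInd {V : Type*} (G : SimpleGraph V) (u w : V) : ℝ :=
  if G.Adj u w then 1 else 0

lemma adjInd_nonneg {V : Type*} (G : SimpleGraph V) (u w : V) : 0 ≤ adjInd G u w := by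
  unfold adjInd; split_ifs <;> norm_num

lemma adjInd_le_one {V : Type*} (G : SimpleGraph V) (u w : V) : adjInd G u w ≤ 1 := by
  unfold adjInd; split_ifs <;> norm_num

lemma adjInd_sq {V : Type*} (G : SimpleGraph V) (u w : V) : adjInd G u w ^ 2 = adjInd G u w := by
  unfold adjInd; split_ifs <;> norm_num

lemma adjInd_comm {V : Type*} (G : SimpleGraph V) (u w : V) : adjInd G u w = adjInd G w u := by
  have h := G.adj_comm u w
  unfold adjInd
  split_ifs <;> tauto

lemma adjMat_apply {V : Type*} [Fintype V] (G : SimpleGraph V) (u w : V) :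
    adjMat G u w = adjInd G u w := by
  simp [adjMat, adjInd, adjMatrix_apply]

lemma two_mul_eCnt {V : Type*} [Fintype V] (G : SimpleGraph V) :
    2 * (eCnt G : ℝ) = ∑ u, ∑ w, adjInd G u w := by
  classical
  have h := G.sum_degrees_eq_twice_card_edges
  have h1 : eCnt G = G.edgeFinset.card := by
    rw [eCnt, Nat.card_eq_fintype_card, edgeFinset_card]
  rw [h1]
  have h2 : (2 * (G.edgeFinset.card : ℝ)) = ∑ v, (G.degree v : ℝ) := by exact_mod_cast h.symm
  rw [h2]
  refine Finset.sum_congr rfl fun u _ => ?_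
  simp only [adjInd, Finset.sum_boole]
  congr 2
  rw [← card_neighborFinset_eq_degree, neighborFinset_eq_filter]

lemma deg_eq_sum {n : ℕ} (G : SimpleGraph (Fin n)) (v : Fin n) :
    (deg G v : ℝ) = ∑ w, adjInd G v w := by
  classical
  simp only [adjInd, Finset.sum_boole, deg]
  rw [Nat.card_eq_fintype_card, Fintype.card_subtype]
  simp [mem_neighborSet]

open scoped Classical in
lemma degIn_eq_sum {n r : ℕ} (G : SimpleGraph (Fin n)) (p : Fin n → Fin r) (i : Fin r)
    (v : Fin n) : (degIn G p i v : ℝ) = ∑ w, if p w = i then adjInd G v w else 0 := by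
  simp only [adjInd, ← ite_and, Finset.sum_boole, degIn]
  rw [Nat.card_eq_fintype_card, Fintype.card_subtype]
  simp [and_comm]

open scoped Classical in
lemma two_mul_crossCnt {n r : ℕ} (G : SimpleGraph (Fin n)) (p : Fin n → Fin r) :
    2 * (crossCnt G p : ℝ) = ∑ u, ∑ w, if p u ≠ p w then adjInd G u w else 0 := by
  let H : SimpleGraph (Fin n) :=
    { Adj := fun u w => G.Adj u w ∧ p u ≠ p w
      symm := ⟨fun u w h => ⟨h.1.symm, h.2.symm⟩⟩
      loopless := ⟨fun u h => h.2 rfl⟩ }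
  have h1 : crossCnt G p = eCnt H := by
    unfold crossCnt eCnt
    refine Nat.card_congr (Equiv.subtypeEquivRight fun e => ?_)
    induction e with
    | h u w => simp [H]
  rw [h1, two_mul_eCnt]
  simp only [adjInd, H]
  refine Finset.sum_congr rfl fun u _ => Finset.sum_congr rfl fun w _ => ?_
  split_ifs <;> tauto

open scoped Classical in
lemma two_mul_inCnt {n r : ℕ} (G : SimpleGraph (Fin n)) (p : Fin n → Fin r) (i : Fin r) :
    2 * (inCnt G p i : ℝ) = ∑ u, ∑ w, if p u = i ∧ p w = i then adjInd G u w else 0 := by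
  let H : SimpleGraph (Fin n) :=
    { Adj := fun u w => G.Adj u w ∧ p u = i ∧ p w = i
      symm := ⟨fun u w h => ⟨h.1.symm, h.2.2, h.2.1⟩⟩
      loopless := ⟨fun u h => G.loopless.irrefl u h.1⟩ }
  have h1 : inCnt G p i = eCnt H := by
    unfold inCnt eCnt
    refine Nat.card_congr (Equiv.subtypeEquivRight fun e => ?_)
    induction e with
    | h u w => simp [H, Sym2.diag]
  rw [h1, two_mul_eCnt]
  simp only [adjInd, H]
  refine Finset.sum_congr rfl fun u _ => Finset.sum_congr rfl fun w _ => ?_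
  split_ifs <;> tauto

lemma two_mul_eCnt_eq_cross_add_in {n r : ℕ} (G : SimpleGraph (Fin n)) (p : Fin n → Fin r) :
    2 * (eCnt G : ℝ) = 2 * (crossCnt G p : ℝ) + 2 * ∑ i, (inCnt G p i : ℝ) := by
  classical
  rw [two_mul_eCnt, two_mul_crossCnt, Finset.mul_sum]
  simp_rw [two_mul_inCnt]
  rw [Finset.sum_comm (s := (Finset.univ : Finset (Fin r))), ← Finset.sum_add_distrib]
  refine Finset.sum_congr rfl fun u _ => ?_
  rw [Finset.sum_comm (s := (Finset.univ : Finset (Fin r))), ← Finset.sum_add_distrib]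
  refine Finset.sum_congr rfl fun w _ => ?_
  by_cases h : p u = p w
  · simp [h]
  · have : ∀ i, ¬ (p u = i ∧ p w = i) := fun i hi => h (hi.1.trans hi.2.symm)
    simp [h, this]

lemma adjMat_isHermitian {V : Type*} [Fintype V] (G : SimpleGraph V) :
    (adjMat G).IsHermitian := by
  ext u w
  simp [Matrix.conjTranspose_apply, adjMat_apply, adjInd_comm G u w]

lemma specRad_mem_spectrum {V : Type*} [Fintype V] [DecidableEq V] [Nonempty V]
    (G : SimpleGraph V) : specRad G ∈ spectrum ℝ (adjMat G) := by
  have h := (adjMat_isHermitian G).spectrum_real_eq_range_eigenvalues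
  rw [specRad, h]
  exact (Set.range_nonempty _).csSup_mem (Set.finite_range _)

lemma quadratic_form_le_specRad {V : Type*} [Fintype V] [DecidableEq V] [Nonempty V]
    (G : SimpleGraph V) (x : V → ℝ) :
    ∑ u, ∑ w, adjInd G u w * x u * x w ≤ specRad G * ∑ u, x u ^ 2 := by
  have hpos : (algebraMap ℝ (Matrix V V ℝ) (specRad G) - adjMat G).PosSemidef := by
    rw [Matrix.posSemidef_iff_isHermitian_and_spectrum_nonneg]
    constructor
    · refine Matrix.IsHermitian.sub ?_ (adjMat_isHermitian G)
      rw [Matrix.algebraMap_eq_diagonal]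
      exact Matrix.isHermitian_diagonal _
    · rw [← spectrum.singleton_sub_eq]
      rintro _ ⟨a, rfl, b, hb, rfl⟩
      have hfin : (spectrum ℝ (adjMat G)).Finite := by
        rw [(adjMat_isHermitian G).spectrum_real_eq_range_eigenvalues]
        exact Set.finite_range _
      exact sub_nonneg.2 (le_csSup hfin.bddAbove hb)
  have h := hpos.dotProduct_mulVec_nonneg x
  rw [Matrix.sub_mulVec, dotProduct_sub] at h
  rw [sub_nonneg] at h
  have h1 : star x ⬝ᵥ (adjMat G).mulVec x = ∑ u, ∑ w, adjInd G u w * x u * x w := by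
    simp only [dotProduct, Matrix.mulVec, adjMat_apply, Finset.mul_sum, star_trivial]
    exact Finset.sum_congr rfl fun u _ => Finset.sum_congr rfl fun w _ => by ring
  have h2 : star x ⬝ᵥ (algebraMap ℝ (Matrix V V ℝ) (specRad G)).mulVec x
      = specRad G * ∑ u, x u ^ 2 := by
    simp only [Matrix.algebraMap_eq_diagonal, dotProduct, Matrix.mulVec_diagonal, Finset.mul_sum,
      star_trivial]
    exact Finset.sum_congr rfl fun u _ => by simp; ring
  rwa [h1, h2] at h

lemma exists_unit_eigenvector {V : Type*} [Fintype V] [DecidableEq V] [Nonempty V]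
    (G : SimpleGraph V) : ∃ x : V → ℝ, ∑ u, x u ^ 2 = 1 ∧
      ∀ u, ∑ w, adjInd G u w * x w = specRad G * x u := by
  have hA := adjMat_isHermitian G
  have hm := specRad_mem_spectrum G
  rw [hA.spectrum_real_eq_range_eigenvalues] at hm
  obtain ⟨i, hi⟩ := hm
  refine ⟨fun u => hA.eigenvectorBasis i u, ?_, fun u => ?_⟩
  · have h := hA.eigenvectorBasis.orthonormal.1 i
    rw [EuclideanSpace.norm_eq, Real.sqrt_eq_one] at h
    simpa using h
  · have h := congrFun (hA.mulVec_eigenvectorBasis i) u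
    rw [hi] at h
    simpa [Matrix.mulVec, dotProduct, adjMat_apply] using h

lemma sum_prod_weights {K V : Type*} [Fintype K] [DecidableEq K] [Fintype V]
    (y : K → V → ℝ) : ∑ v : K → V, ∏ k, y k (v k) = ∏ k, ∑ u, y k u := by
  classical
  rw [Finset.prod_univ_sum, Fintype.piFinset_univ]

lemma sum_prod_weights_pair {K V : Type*} [Fintype K] [DecidableEq K] [Fintype V]
    [DecidableEq V] (y : K → V → ℝ) (hy : ∀ k, ∑ u, y k u = 1) {i j : K} (hij : i ≠ j)
    (g : V → V → ℝ) :
    ∑ v : K → V, (∏ k, y k (v k)) * g (v i) (v j) = ∑ u, ∑ w, y i u * y j w * g u w := by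
  have key : ∀ a b : V, ∑ v : K → V, (∏ k, y k (v k)) *
      ((if v i = a then 1 else 0) * (if v j = b then 1 else 0)) = y i a * y j b := by
    intro a b
    let z : K → V → ℝ := fun k t =>
      y k t * ((if k = i then (if t = a then 1 else 0) else 1) *
        (if k = j then (if t = b then 1 else 0) else 1))
    have h1 : ∀ v : K → V, (∏ k, y k (v k)) *
        ((if v i = a then 1 else 0) * (if v j = b then 1 else 0)) = ∏ k, z k (v k) := by
      intro v
      simp only [z, Finset.prod_mul_distrib]
      congr 2
      · rw [Finset.prod_ite_eq' Finset.univ i]; simp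
      · rw [Finset.prod_ite_eq' Finset.univ j]; simp
    simp_rw [h1]
    rw [sum_prod_weights]
    have h2 : ∀ k, ∑ u, z k u = (if k = i then y i a else 1) * (if k = j then y j b else 1) := by
      intro k
      by_cases hki : k = i
      · subst hki; simp [z, hij]
      · by_cases hkj : k = j
        · subst hkj; simp [z, hki]
        · simp [z, hki, hkj, hy]
    simp_rw [h2, Finset.prod_mul_distrib]
    simp
  have h3 : ∀ v : K → V, (∏ k, y k (v k)) * g (v i) (v j) = ∑ a, ∑ b, (∏ k, y k (v k)) *
      ((if v i = a then 1 else 0) * (if v j = b then 1 else 0)) * g a b := by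
    intro v
    rw [Finset.sum_eq_single (v i), Finset.sum_eq_single (v j)]
    · simp
    · intro b _ hb; simp [hb.symm]
    · simp
    · intro a _ ha; simp [ha.symm]
    · simp
  simp_rw [h3]
  rw [Finset.sum_comm]
  refine Finset.sum_congr rfl fun a _ => ?_
  rw [Finset.sum_comm]
  refine Finset.sum_congr rfl fun b _ => ?_
  rw [← Finset.sum_mul, key]

/-- A lower bound on a sum of pairwise interactions that holds for every choice of points
of positive weight also holds on average, when the points are chosen independently with distributions `y k`. -/
lemma le_sum_pair_expectation {K V : Type*} [Fintype K] [DecidableEq K] [Fintype V]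
    [DecidableEq V] (y : K → V → ℝ) (hy0 : ∀ k u, 0 ≤ y k u) (hy : ∀ k, ∑ u, y k u = 1)
    (g : K → K → V → V → ℝ) (C : ℝ)
    (h : ∀ v : K → V, (∀ k, y k (v k) ≠ 0) →
      C ≤ ∑ i, ∑ j ∈ Finset.univ.erase i, g i j (v i) (v j)) :
    C ≤ ∑ i, ∑ j ∈ Finset.univ.erase i, ∑ u, ∑ w, y i u * y j w * g i j u w := by
  have h1 : ∑ v : K → V, ∏ k, y k (v k) = 1 := by
    rw [sum_prod_weights]; simp [hy]
  calc C = ∑ v : K → V, (∏ k, y k (v k)) * C := by rw [← Finset.sum_mul, h1, one_mul]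
    _ ≤ ∑ v : K → V, (∏ k, y k (v k)) * ∑ i, ∑ j ∈ Finset.univ.erase i, g i j (v i) (v j) :=
        Finset.sum_le_sum fun v _ => by
          by_cases hv : ∀ k, y k (v k) ≠ 0
          · exact mul_le_mul_of_nonneg_left (h v hv) (Finset.prod_nonneg fun k _ => hy0 k _)
          · push Not at hv
            obtain ⟨k, hk⟩ := hv
            have h0 : ∏ k, y k (v k) = 0 :=
              Finset.prod_eq_zero (f := fun k => y k (v k)) (Finset.mem_univ k) hk
            rw [h0, zero_mul, zero_mul]
    _ = _ := by
        simp_rw [Finset.mul_sum]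
        rw [Finset.sum_comm]
        refine Finset.sum_congr rfl fun i _ => ?_
        rw [Finset.sum_comm]
        refine Finset.sum_congr rfl fun j hj => ?_
        exact sum_prod_weights_pair y hy (Finset.ne_of_mem_erase hj).symm (g i j)

lemma eCnt_turanGraph (n r : ℕ) : eCnt (turanGraph n r) = (turanGraph n r).edgeFinset.card := by
  rw [eCnt, Nat.card_eq_fintype_card, edgeFinset_card]

lemma two_mul_eCnt_turanGraph_le {r : ℕ} (hr : 2 ≤ r) (n : ℕ) :
    2 * (eCnt (turanGraph n r) : ℝ) ≤ (1 - 1 / (r : ℝ)) * n ^ 2 := by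
  have h := mul_card_edgeFinset_turanGraph_le (n := n) (r := r)
  rw [← eCnt_turanGraph] at h
  have h' : 2 * (r : ℝ) * eCnt (turanGraph n r) ≤ ((r : ℝ) - 1) * n ^ 2 := by
    have := (Nat.cast_le (α := ℝ)).2 h
    push_cast [Nat.cast_sub (show 1 ≤ r by omega)] at this
    exact this
  have hr0 : (0 : ℝ) < r := by positivity
  have h2 : (1 - 1 / (r : ℝ)) * n ^ 2 = ((r : ℝ) - 1) * n ^ 2 / r := by field_simp
  rw [h2, le_div_iff₀ hr0]
  linarith

lemma le_two_mul_eCnt_turanGraph {r : ℕ} (hr : 2 ≤ r) (n : ℕ) :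
    (1 - 1 / (r : ℝ)) * n ^ 2 - (r ^ 2 + 2) ≤ 2 * (eCnt (turanGraph n r) : ℝ) := by
  have hr0 : (0 : ℝ) < r := by positivity
  set k := n % r with hk
  have hkr : k < r := Nat.mod_lt _ (by omega)
  have hkn : k ≤ n := Nat.mod_le _ _
  have h1 : (n ^ 2 - k ^ 2) * (r - 1) / (2 * r) ≤ eCnt (turanGraph n r) := by
    rw [eCnt_turanGraph, card_edgeFinset_turanGraph]
    exact Nat.le_add_right _ _
  have h2 : (n ^ 2 - k ^ 2) * (r - 1) < 2 * r * (eCnt (turanGraph n r) + 1) := by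
    have := Nat.lt_mul_div_succ ((n ^ 2 - k ^ 2) * (r - 1)) (show 0 < 2 * r by omega)
    exact this.trans_le (Nat.mul_le_mul_left _ (by omega))
  have h3 : ((n : ℝ) ^ 2 - k ^ 2) * ((r : ℝ) - 1) < 2 * r * (eCnt (turanGraph n r) + 1) := by
    have := (Nat.cast_lt (α := ℝ)).2 h2
    push_cast [Nat.cast_sub (show 1 ≤ r by omega),
      Nat.cast_sub (show k ^ 2 ≤ n ^ 2 from Nat.pow_le_pow_left hkn 2)] at this
    exact this
  have h4 : (k : ℝ) ^ 2 * ((r : ℝ) - 1) ≤ r ^ 2 * r := by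
    have hk' : (k : ℝ) ≤ r := by exact_mod_cast hkr.le
    have h1r : (2 : ℝ) ≤ r := by exact_mod_cast hr
    gcongr
    · linarith
    · linarith
  have h5 : (1 - 1 / (r : ℝ)) * n ^ 2 - (r ^ 2 + 2)
      = (((r : ℝ) - 1) * n ^ 2 - (r ^ 2 * r + 2 * r)) / r := by field_simp
  rw [h5, div_le_iff₀ hr0]
  nlinarith

lemma Contains.trans {U V X : Type*} {F : SimpleGraph U} {G : SimpleGraph V} {H : SimpleGraph X}
    (h : Contains F G) (f : G →g H) (hf : Function.Injective f) : Contains F H := by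
  obtain ⟨e, he⟩ := h
  exact ⟨f.comp e, hf.comp he⟩

lemma bddAbove_eCnt_ffree {U : Type*} (n : ℕ) (F : SimpleGraph U) :
    BddAbove {m | ∃ G : SimpleGraph (Fin n), FFree F G ∧ eCnt G = m} := by
  have : (Set.range fun G : SimpleGraph (Fin n) => eCnt G).Finite := Set.finite_range _
  refine this.bddAbove.mono ?_
  rintro m ⟨G, -, rfl⟩
  exact ⟨G, rfl⟩

lemma FFree.eCnt_le_exNum {U : Type*} {n : ℕ} {F : SimpleGraph U} {G : SimpleGraph (Fin n)}
    (h : FFree F G) : eCnt G ≤ exNum n F :=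
  le_csSup (bddAbove_eCnt_ffree n F) ⟨G, h, rfl⟩

lemma exists_ffree_eCnt_eq_exNum {U : Type*} {n : ℕ} {F : SimpleGraph U} (h : exNum n F ≠ 0) :
    ∃ G : SimpleGraph (Fin n), FFree F G ∧ eCnt G = exNum n F := by
  have hne : {m | ∃ G : SimpleGraph (Fin n), FFree F G ∧ eCnt G = m}.Nonempty := by
    by_contra hne
    rw [Set.not_nonempty_iff_eq_empty] at hne
    exact h (by rw [exNum, hne]; simp)
  exact Nat.sSup_mem hne (bddAbove_eCnt_ffree n F)

/-- The edge density bound for `F`-free graphs, for a sample of the vertices. -/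
lemma sum_adjInd_sample_le {U V : Type*} {r a : ℕ} (hr : 2 ≤ r) {F : SimpleGraph U}
    {G : SimpleGraph V} (hG : FFree F G) {m : ℕ} (hm : exNum m F = eCnt (turanGraph m r) + a)
    {v : Fin m → V} (hv : Function.Injective v) :
    ∑ i, ∑ j, adjInd G (v i) (v j) ≤ (1 - 1 / (r : ℝ)) * m ^ 2 + 2 * a := by
  have h1 : FFree F (G.comap v) := fun hc => hG (hc.trans ⟨v, fun h => h⟩ hv)
  have h2 := h1.eCnt_le_exNum
  rw [hm] at h2
  have h3 : (eCnt (G.comap v) : ℝ) ≤ eCnt (turanGraph m r) + a := by exact_mod_cast h2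
  have h4 := two_mul_eCnt (G.comap v)
  have h5 := two_mul_eCnt_turanGraph_le hr m
  have h6 : ∀ i j, adjInd (G.comap v) i j = adjInd G (v i) (v j) := fun i j => rfl
  simp_rw [h6] at h4
  linarith

lemma sample_quadratic_form_le {U V : Type*} [Fintype V] [DecidableEq V] {r a : ℕ} (hr : 2 ≤ r)
    {F : SimpleGraph U} {G : SimpleGraph V} (hG : FFree F G) {m : ℕ} (hm1 : 1 ≤ m)
    (hm : exNum m F = eCnt (turanGraph m r) + a) (y : V → ℝ) (hy0 : ∀ u, 0 ≤ y u)
    (hy : ∑ u, y u = 1) :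
    m * (m - 1) * ∑ u, ∑ w, adjInd G u w * y u * y w ≤
      (1 - 1 / (r : ℝ)) * m ^ 2 + 2 * a + m * (m - 1) * (m ^ 2 * ∑ u, y u ^ 2) := by
  have hc : (0 : ℝ) ≤ 1 - 1 / r := by
    have h1r : (1 : ℝ) ≤ r := by exact_mod_cast (by omega : 1 ≤ r)
    rw [sub_nonneg, div_le_one (by linarith)]; exact h1r
  have key := le_sum_pair_expectation (K := Fin m) (fun _ => y) (fun _ => hy0) (fun _ => hy)
    (fun _ _ u w => (m : ℝ) ^ 2 * (if u = w then 1 else 0) - adjInd G u w)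
    (-((1 - 1 / (r : ℝ)) * m ^ 2 + 2 * a)) ?_
  · have h1 : ∑ u, ∑ w, y u * y w * ((m : ℝ) ^ 2 * (if u = w then 1 else 0) - adjInd G u w)
        = m ^ 2 * ∑ u, y u ^ 2 - ∑ u, ∑ w, adjInd G u w * y u * y w := by
      rw [Finset.mul_sum, ← Finset.sum_sub_distrib]
      refine Finset.sum_congr rfl fun u _ => ?_
      simp_rw [mul_sub, Finset.sum_sub_distrib]
      congr 1
      · simp; ring
      · exact Finset.sum_congr rfl fun w _ => by ring
    simp only [h1, Finset.sum_const, Finset.card_erase_of_mem (Finset.mem_univ _),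
      Finset.card_univ, Fintype.card_fin, nsmul_eq_mul, Nat.cast_sub hm1, Nat.cast_one] at key
    linarith
  · intro v _
    simp_rw [Finset.sum_sub_distrib, ← Finset.mul_sum]
    by_cases hv : Function.Injective v
    · have h1 := sum_adjInd_sample_le hr hG hm hv
      have h2 : ∑ i, ∑ j ∈ Finset.univ.erase i, adjInd G (v i) (v j)
          ≤ ∑ i, ∑ j, adjInd G (v i) (v j) :=
        Finset.sum_le_sum fun i _ => Finset.sum_le_sum_of_subset_of_nonneg
          (Finset.erase_subset _ _) fun j _ _ => adjInd_nonneg _ _ _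
      have h3 : 0 ≤ (m : ℝ) ^ 2 *
          ∑ i, ∑ j ∈ Finset.univ.erase i, (if v i = v j then (1 : ℝ) else 0) := by positivity
      linarith
    · obtain ⟨i, j, hij, hne⟩ : ∃ i j, v i = v j ∧ i ≠ j := by
        simpa [Function.Injective] using hv
      have h1 : 1 ≤ ∑ i, ∑ j ∈ Finset.univ.erase i, (if v i = v j then (1 : ℝ) else 0) := by
        calc (1 : ℝ) = if v i = v j then (1 : ℝ) else 0 := by simp [hij]
          _ ≤ ∑ j ∈ Finset.univ.erase i, (if v i = v j then (1 : ℝ) else 0) :=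
            Finset.single_le_sum (f := fun j => if v i = v j then (1 : ℝ) else 0)
              (fun _ _ => by positivity) (by simp [hne.symm])
          _ ≤ _ := Finset.single_le_sum
              (f := fun i => ∑ j ∈ Finset.univ.erase i, if v i = v j then (1 : ℝ) else 0)
              (fun _ _ => by positivity) (Finset.mem_univ i)
      have h2 : ∑ i, ∑ j ∈ Finset.univ.erase i, adjInd G (v i) (v j) ≤ (m : ℝ) ^ 2 := by
        calc ∑ i, ∑ j ∈ Finset.univ.erase i, adjInd G (v i) (v j)
            ≤ ∑ i : Fin m, ∑ j : Fin m, (1 : ℝ) := Finset.sum_le_sum fun i _ =>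
              (Finset.sum_le_sum fun j _ => adjInd_le_one _ _ _).trans
                (Finset.sum_le_sum_of_subset_of_nonneg (Finset.erase_subset _ _)
                  fun _ _ _ => zero_le_one)
          _ = (m : ℝ) ^ 2 := by simp; ring
      have h3 : 0 ≤ (1 - 1 / (r : ℝ)) * m ^ 2 + 2 * a := by positivity
      nlinarith [sq_nonneg (m : ℝ)]

/-- An approximate Motzkin–Straus inequality for `F`-free graphs and spread out weights. -/
lemma quadratic_form_le_density {U : Type*} {r a : ℕ} (hr : 2 ≤ r) {F : SimpleGraph U}
    (h : HypStar r a F) {η : ℝ} (hη : 0 < η) (C : ℝ) :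
    ∃ n₀ : ℕ, ∀ n ≥ n₀, ∀ G : SimpleGraph (Fin n), FFree F G → ∀ y : Fin n → ℝ,
      (∀ u, 0 ≤ y u) → ∑ u, y u = 1 → (∀ u, y u ≤ C / n) →
      ∑ u, ∑ w, adjInd G u w * y u * y w ≤ 1 - 1 / (r : ℝ) + η := by
  obtain ⟨m₀, hm₀⟩ := h
  obtain ⟨b, hb⟩ := exists_nat_ge (2 * (1 + 2 * (a : ℝ)) / η)
  set m : ℕ := max m₀ (b + 2) with hm
  have hmm : m₀ ≤ m := le_max_left _ _
  have hmb : b + 2 ≤ m := le_max_right _ _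
  obtain ⟨N, hN⟩ := exists_nat_ge (2 * (m : ℝ) ^ 2 * C / η)
  refine ⟨N + 1, fun n hn G hG y hy0 hy hyC => ?_⟩
  have hmain := sample_quadratic_form_le hr hG (by omega) (hm₀ m hmm).1 y hy0 hy
  have hmR : (b : ℝ) + 2 ≤ m := by exact_mod_cast hmb
  have hnR : (N : ℝ) + 1 ≤ n := by exact_mod_cast hn
  have hn0 : (0 : ℝ) < n := by linarith [Nat.cast_nonneg (α := ℝ) N]
  have hsq : ∑ u, y u ^ 2 ≤ C / n := by
    calc ∑ u, y u ^ 2 ≤ ∑ u, C / n * y u :=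
          Finset.sum_le_sum fun u _ => by nlinarith [hyC u, hy0 u]
      _ = C / n := by rw [← Finset.mul_sum, hy, mul_one]
  have hb0 : (0 : ℝ) ≤ b := by positivity
  have h1 : (m : ℝ) ^ 2 * ∑ u, y u ^ 2 ≤ η / 2 := by
    have h2 : (m : ℝ) ^ 2 * ∑ u, y u ^ 2 ≤ m ^ 2 * (C / n) := by gcongr
    refine h2.trans ?_
    rw [← mul_div_assoc, div_le_iff₀ hn0]
    rw [div_le_iff₀ hη] at hN
    nlinarith
  have h2 : (1 + 2 * (a : ℝ)) ≤ η / 2 * (m - 1) := by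
    rw [div_le_iff₀ hη] at hb
    nlinarith
  have hc : 1 - 1 / (r : ℝ) ≤ 1 := by
    have : (0 : ℝ) ≤ 1 / r := by positivity
    linarith
  have hm1 : (1 : ℝ) ≤ m - 1 := by linarith
  have hP : (0 : ℝ) < m * (m - 1) := by nlinarith
  have ha : (0 : ℝ) ≤ a := by positivity
  set c : ℝ := 1 - 1 / (r : ℝ)
  set Q := ∑ u, ∑ w, adjInd G u w * y u * y w
  have h3 : c * (m : ℝ) ^ 2 + 2 * a ≤ m * (m - 1) * (c + η / 2) := by nlinarith
  have h4 : (m : ℝ) * (m - 1) * (m ^ 2 * ∑ u, y u ^ 2) ≤ m * (m - 1) * (η / 2) := by gcongr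
  have h5 : (m : ℝ) * (m - 1) * Q ≤ m * (m - 1) * (c + η) := by linarith
  exact le_of_mul_le_mul_left h5 hP

lemma half_le_one_sub_inv {r : ℕ} (hr : 2 ≤ r) : (1 : ℝ) / 2 ≤ 1 - 1 / (r : ℝ) := by
  have h : (1 : ℝ) / r ≤ 1 / 2 := one_div_le_one_div_of_le (by norm_num) (by exact_mod_cast hr)
  linarith

lemma SpecExtremal.le_specRad {U : Type*} {r a : ℕ} (hr : 2 ≤ r) {F : SimpleGraph U}
    (h : HypStar r a F) {η : ℝ} (hη : 0 < η) :
    ∃ n₀ : ℕ, ∀ n ≥ n₀, ∀ G : SimpleGraph (Fin n), SpecExtremal F G →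
      (1 - 1 / (r : ℝ) - η) * n ≤ specRad G := by
  obtain ⟨m₀, hm₀⟩ := h
  obtain ⟨N, hN⟩ := exists_nat_ge (((r : ℝ) ^ 2 + 2) / η)
  refine ⟨max m₀ (N + r ^ 2 + 3), fun n hn G hG => ?_⟩
  have hnm : m₀ ≤ n := (le_max_left _ _).trans hn
  have hnN : N + r ^ 2 + 3 ≤ n := (le_max_right _ _).trans hn
  have hnR : (N : ℝ) + r ^ 2 + 3 ≤ n := by exact_mod_cast hnN
  have hN0 : (0 : ℝ) ≤ N := by positivity
  have hr0 : (0 : ℝ) ≤ (r : ℝ) ^ 2 := by positivity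
  have hn0 : (0 : ℝ) < n := by linarith
  have : Nonempty (Fin n) := ⟨⟨0, by omega⟩⟩
  have hT := le_two_mul_eCnt_turanGraph hr n
  have hc := half_le_one_sub_inv hr
  set c : ℝ := 1 - 1 / (r : ℝ)
  have hex := (hm₀ n hnm).1
  have hexR : (exNum n F : ℝ) = eCnt (turanGraph n r) + a := by exact_mod_cast hex
  have ha : (0 : ℝ) ≤ a := by positivity
  have hne : exNum n F ≠ 0 := by
    intro h0
    rw [h0, Nat.cast_zero] at hexR
    nlinarith
  obtain ⟨G', hG', hE⟩ := exists_ffree_eCnt_eq_exNum hne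
  have hER : (eCnt G' : ℝ) = exNum n F := by exact_mod_cast hE
  have hle := hG.2 G' hG'
  have hq := quadratic_form_le_specRad G' (fun _ => 1)
  simp only [mul_one, one_pow, Finset.sum_const, Finset.card_univ, Fintype.card_fin,
    nsmul_eq_mul, ← two_mul_eCnt] at hq
  rw [div_le_iff₀ hη] at hN
  have h0 : (r : ℝ) ^ 2 + 2 ≤ η * n ^ 2 := by
    calc (r : ℝ) ^ 2 + 2 ≤ N * η := hN
      _ ≤ n ^ 2 * η := by gcongr; nlinarith
      _ = η * n ^ 2 := mul_comm _ _
  have h1 : (c - η) * n * n ≤ specRad G * n := by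
    have := mul_le_mul_of_nonneg_right hle hn0.le
    linarith
  exact le_of_mul_le_mul_right h1 hn0

/-- Spectral extremal graphs have nearly as many edges as the Turán graph. -/
lemma SpecExtremal.le_two_mul_eCnt {U : Type*} {r a : ℕ} (hr : 2 ≤ r) {F : SimpleGraph U}
    (h : HypStar r a F) {η : ℝ} (hη : 0 < η) (hη4 : η ≤ 1 / 4) :
    ∃ n₀ : ℕ, ∀ n ≥ n₀, ∀ G : SimpleGraph (Fin n), SpecExtremal F G →
      (1 - 1 / (r : ℝ) - 3 * η) * n ^ 2 ≤ 2 * (eCnt G : ℝ) := by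
  obtain ⟨n₁, hn₁⟩ := SpecExtremal.le_specRad hr h hη
  obtain ⟨n₂, hn₂⟩ := quadratic_form_le_density hr h hη 16
  refine ⟨n₁ + n₂ + 1, fun n hn G hG => ?_⟩
  have hspec := hn₁ n (by omega) G hG
  have hdens := hn₂ n (by omega) G hG.1
  have hc := half_le_one_sub_inv hr
  set c : ℝ := 1 - 1 / (r : ℝ)
  have : Nonempty (Fin n) := ⟨⟨0, by omega⟩⟩
  have hn0 : (0 : ℝ) < n := by exact_mod_cast (by omega : 0 < n)
  set lam := specRad G
  have hlam : (n : ℝ) / 4 ≤ lam := by nlinarith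
  have hlam0 : 0 < lam := by linarith
  obtain ⟨x, hx1, hx⟩ := exists_unit_eigenvector G
  have hsmall : ∀ u, x u ^ 2 ≤ 16 / n := by
    intro u
    have h1 : (lam * x u) ^ 2 ≤ n := by
      rw [← hx u]
      refine (Finset.sum_mul_sq_le_sq_mul_sq _ _ _).trans ?_
      rw [hx1, mul_one]
      calc ∑ w, adjInd G u w ^ 2 ≤ ∑ _w : Fin n, (1 : ℝ) := Finset.sum_le_sum fun w _ => by
            rw [adjInd_sq]; exact adjInd_le_one _ _ _
        _ = n := by simp
    rw [le_div_iff₀ hn0]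
    have h2 : (n : ℝ) ^ 2 / 16 ≤ lam ^ 2 := by nlinarith
    have h3 : (n : ℝ) ^ 2 / 16 * x u ^ 2 ≤ n := by
      calc (n : ℝ) ^ 2 / 16 * x u ^ 2 ≤ lam ^ 2 * x u ^ 2 := by gcongr
        _ = (lam * x u) ^ 2 := by ring
        _ ≤ n := h1
    have h4 : (n : ℝ) * (x u ^ 2 * n) ≤ n * 16 := by nlinarith
    exact le_of_mul_le_mul_left h4 hn0
  have hQ := hdens (fun u => x u ^ 2) (fun u => sq_nonneg _) hx1 hsmall
  have hquad : ∑ u, ∑ w, adjInd G u w * (x u * x w) = lam := by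
    calc ∑ u, ∑ w, adjInd G u w * (x u * x w) = ∑ u, x u * ∑ w, adjInd G u w * x w := by
          simp_rw [Finset.mul_sum]
          exact Finset.sum_congr rfl fun u _ => Finset.sum_congr rfl fun w _ => by ring
      _ = lam * ∑ u, x u ^ 2 := by
          simp_rw [hx, Finset.mul_sum]
          exact Finset.sum_congr rfl fun u _ => by ring
      _ = lam := by rw [hx1, mul_one]
  have hCS : lam ^ 2 ≤ 2 * eCnt G * ∑ u, ∑ w, adjInd G u w * x u ^ 2 * x w ^ 2 := by
    have h1 := Finset.sum_mul_sq_le_sq_mul_sq (Finset.univ : Finset (Fin n × Fin n))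
      (fun z => adjInd G z.1 z.2) (fun z => adjInd G z.1 z.2 * (x z.1 * x z.2))
    have h2 : ∀ z : Fin n × Fin n, adjInd G z.1 z.2 * (adjInd G z.1 z.2 * (x z.1 * x z.2))
        = adjInd G z.1 z.2 * (x z.1 * x z.2) := fun z => by
      rw [← mul_assoc, ← sq, adjInd_sq]
    have h3 : ∀ z : Fin n × Fin n, (adjInd G z.1 z.2 * (x z.1 * x z.2)) ^ 2
        = adjInd G z.1 z.2 * x z.1 ^ 2 * x z.2 ^ 2 := fun z => by
      rw [mul_pow, adjInd_sq]; ring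
    simp_rw [h2, h3, adjInd_sq, Fintype.sum_prod_type] at h1
    rwa [hquad, ← two_mul_eCnt] at h1
  have he : (0 : ℝ) ≤ 2 * eCnt G := by positivity
  have h1 : ((c - η) * n) ^ 2 ≤ 2 * eCnt G * (c + η) := by
    calc ((c - η) * n) ^ 2 ≤ lam ^ 2 := by
          have : 0 ≤ (c - η) * n := mul_nonneg (by linarith) hn0.le
          gcongr
      _ ≤ _ := hCS
      _ ≤ _ := by gcongr
  have h2 : (c + η) * ((c - 3 * η) * n ^ 2) ≤ (c + η) * (2 * eCnt G) := by
    have h3 : (c + η) * ((c - 3 * η) * n ^ 2) ≤ ((c - η) * n) ^ 2 := by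
      have : 0 ≤ (4 * η ^ 2) * (n : ℝ) ^ 2 := by positivity
      nlinarith
    linarith
  exact le_of_mul_le_mul_left h2 (by linarith)

lemma sum_adjInd_le_add_two_mul_sum_deg {n : ℕ} (G : SimpleGraph (Fin n)) (T : Finset (Fin n)) :
    ∑ u, ∑ w, adjInd G u w ≤
      ∑ u ∈ Tᶜ, ∑ w ∈ Tᶜ, adjInd G u w + 2 * ∑ u ∈ T, (deg G u : ℝ) := by
  rw [← Finset.sum_compl_add_sum T]
  have h1 : ∑ u ∈ Tᶜ, ∑ w, adjInd G u w
      = ∑ u ∈ Tᶜ, ∑ w ∈ Tᶜ, adjInd G u w + ∑ w ∈ T, ∑ u ∈ Tᶜ, adjInd G u w := by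
    rw [Finset.sum_comm (s := T), ← Finset.sum_add_distrib]
    exact Finset.sum_congr rfl fun u _ => (Finset.sum_compl_add_sum T _).symm
  have h2 : ∑ w ∈ T, ∑ u ∈ Tᶜ, adjInd G u w ≤ ∑ u ∈ T, (deg G u : ℝ) := by
    refine Finset.sum_le_sum fun w _ => ?_
    rw [deg_eq_sum]
    simp_rw [fun u => adjInd_comm G u w]
    exact Finset.sum_le_sum_of_subset_of_nonneg (Finset.subset_univ _)
      fun _ _ _ => adjInd_nonneg _ _ _
  simp_rw [← deg_eq_sum] at h1 ⊢
  linarith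

/-- There are few vertices of low degree. -/
lemma card_Lset_le {U : Type*} {r a : ℕ} (hr : 2 ≤ r) {F : SimpleGraph U} (h : HypStar r a F)
    {ε δ : ℝ} (hδ : 0 < δ) (hδ2 : δ ≤ 1 / 2) (hε : δ ^ 3 = ε) :
    ∃ n₀ : ℕ, ∀ n ≥ n₀, ∀ G : SimpleGraph (Fin n), FFree F G →
      (1 - 1 / (r : ℝ) - ε) * n ^ 2 ≤ 2 * (eCnt G : ℝ) →
      (Nat.card ↥{v | (deg G v : ℝ) ≤ (1 - 1 / (r : ℝ) - 3 * r * δ) * n} : ℝ) ≤ δ * n := by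
  classical
  obtain ⟨m₀, hm₀⟩ := h
  obtain ⟨N, hN⟩ := exists_nat_ge ((2 + (a : ℝ)) / δ)
  refine ⟨max (2 * m₀) N, fun n hn G hG hE => ?_⟩
  have hnm : 2 * m₀ ≤ n := (le_max_left _ _).trans hn
  have hnN : (N : ℝ) ≤ n := by exact_mod_cast (le_max_right _ _).trans hn
  rw [div_le_iff₀ hδ] at hN
  have ht : 2 + (a : ℝ) ≤ δ * n := by nlinarith
  have ha : (0 : ℝ) ≤ a := by positivity
  have hn0 : (0 : ℝ) ≤ n := by positivity
  by_contra! hcon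
  set L : Finset (Fin n) :=
    Finset.univ.filter fun v => (deg G v : ℝ) ≤ (1 - 1 / (r : ℝ) - 3 * r * δ) * n with hL
  have hcard : Nat.card ↥{v | (deg G v : ℝ) ≤ (1 - 1 / (r : ℝ) - 3 * r * δ) * n} = L.card := by
    rw [Nat.card_eq_fintype_card, Fintype.card_subtype]
    rfl
  rw [hcard] at hcon
  set k := ⌊δ * n⌋₊ with hk
  have hk1 : (k : ℝ) ≤ δ * n := Nat.floor_le (by positivity)
  have hk2 : δ * n < k + 1 := Nat.lt_floor_add_one _
  have hkL : k ≤ L.card := by exact_mod_cast (hk1.trans_lt hcon).le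
  obtain ⟨T, hTL, hTk⟩ := Finset.exists_subset_card_eq hkL
  have hkn : k ≤ n := hkL.trans (by simpa using Finset.card_le_univ L)
  have hS : Tᶜ.card = n - k := by rw [Finset.card_compl, hTk, Fintype.card_fin]
  have hmk : m₀ ≤ n - k := by
    have : (k : ℝ) * 2 ≤ n := by nlinarith
    have : k * 2 ≤ n := by exact_mod_cast this
    omega
  let e := Tᶜ.orderEmbOfFin hS
  have hsample := sum_adjInd_sample_le hr hG (hm₀ (n - k) hmk).1 e.injective
  have himg : Finset.univ.map e.toEmbedding = Tᶜ := by
    rw [Finset.map_eq_image]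
    exact Finset.image_orderEmbOfFin_univ _ _
  have hsum : ∑ i, ∑ j, adjInd G (e i) (e j) = ∑ u ∈ Tᶜ, ∑ w ∈ Tᶜ, adjInd G u w := by
    rw [← himg]
    simp only [Finset.sum_map]
    rfl
  rw [hsum, Nat.cast_sub hkn] at hsample
  have hsplit := sum_adjInd_le_add_two_mul_sum_deg G T
  rw [← two_mul_eCnt] at hsplit
  have hdeg : ∑ u ∈ T, (deg G u : ℝ) ≤ k * ((1 - 1 / (r : ℝ) - 3 * r * δ) * n) := by
    rw [← hTk, ← nsmul_eq_mul]
    exact Finset.sum_le_card_nsmul _ _ _ fun u hu => (Finset.mem_filter.1 (hTL hu)).2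
  have hc1 : 1 - 1 / (r : ℝ) ≤ 1 := by
    have : (0 : ℝ) ≤ 1 / r := by positivity
    linarith
  set c : ℝ := 1 - 1 / (r : ℝ)
  have hrR : (2 : ℝ) ≤ r := by exact_mod_cast hr
  have hk0 : (0 : ℝ) ≤ k := by positivity
  have h1 : c * (k : ℝ) ^ 2 ≤ δ * n * k := by nlinarith
  have h2 : 12 * (δ * n * k) ≤ 6 * (r * δ * k * n) := by
    have : 0 ≤ δ * n * k := by positivity
    nlinarith
  have h3 : ε * n ^ 2 ≤ (δ * n) ^ 2 := by
    have : δ ^ 3 ≤ δ ^ 2 := pow_le_pow_of_le_one hδ.le (by linarith) (by norm_num)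
    rw [← hε, mul_pow]
    gcongr
  have h4 : 11 * (δ * n * k) ≤ (δ * n) ^ 2 + 2 * a := by nlinarith
  nlinarith

lemma sum_sum_eq_of_symm {V : Type*} [Fintype V] [DecidableEq V] (f : V → V → ℝ) (v : V)
    (hf : ∀ u w, f u w = f w u) (h0 : f v v = 0) :
    ∑ u, ∑ w, f u w =
      ∑ u ∈ Finset.univ.erase v, ∑ w ∈ Finset.univ.erase v, f u w + 2 * ∑ w, f v w := by
  rw [← Finset.add_sum_erase _ _ (Finset.mem_univ v)]
  have h1 : ∑ u ∈ Finset.univ.erase v, ∑ w, f u w = ∑ u ∈ Finset.univ.erase v, f v u +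
      ∑ u ∈ Finset.univ.erase v, ∑ w ∈ Finset.univ.erase v, f u w := by
    rw [← Finset.sum_add_distrib]
    refine Finset.sum_congr rfl fun u _ => ?_
    rw [← Finset.add_sum_erase _ _ (Finset.mem_univ v), hf u v]
  have h2 : ∑ w, f v w = ∑ w ∈ Finset.univ.erase v, f v w := by
    rw [← Finset.add_sum_erase _ _ (Finset.mem_univ v), h0, zero_add]
  rw [h1, h2]
  ring

/-- In a partition with the maximum number of crossing edges, every vertex has at least as many
neighbours in each other part as in its own part. -/
lemma degIn_own_le {n r : ℕ} {G : SimpleGraph (Fin n)} {p : Fin n → Fin r}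
    (hmax : ∀ q : Fin n → Fin r, crossCnt G q ≤ crossCnt G p) (v : Fin n) (i : Fin r) :
    (degIn G p (p v) v : ℝ) ≤ degIn G p i v := by
  classical
  have hloop : adjInd G v v = 0 := by simp [adjInd]
  set q := Function.update p v i with hq
  have hqv : q v = i := by simp [hq]
  have hqw : ∀ w, w ≠ v → q w = p w := fun w hw => by simp [hq, hw]
  have hle : 2 * (crossCnt G q : ℝ) ≤ 2 * (crossCnt G p : ℝ) := by
    have := hmax q
    gcongr
  have hsymm : ∀ (s : Fin n → Fin r) (u w : Fin n), (if s u ≠ s w then adjInd G u w else 0)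
      = if s w ≠ s u then adjInd G w u else 0 := fun s u w => by
    simp only [adjInd_comm G u w, ne_comm (a := s u)]
  rw [two_mul_crossCnt, two_mul_crossCnt, sum_sum_eq_of_symm _ v (hsymm q) (by simp),
    sum_sum_eq_of_symm _ v (hsymm p) (by simp)] at hle
  have hrest : ∑ u ∈ Finset.univ.erase v, ∑ w ∈ Finset.univ.erase v,
        (if q u ≠ q w then adjInd G u w else 0)
      = ∑ u ∈ Finset.univ.erase v, ∑ w ∈ Finset.univ.erase v,
        (if p u ≠ p w then adjInd G u w else 0) :=
    Finset.sum_congr rfl fun u hu => Finset.sum_congr rfl fun w hw => by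
      rw [hqw u (Finset.ne_of_mem_erase hu), hqw w (Finset.ne_of_mem_erase hw)]
  have hp : ∑ w, (if p v ≠ p w then adjInd G v w else 0) = deg G v - degIn G p (p v) v := by
    rw [deg_eq_sum, degIn_eq_sum, ← Finset.sum_sub_distrib]
    refine Finset.sum_congr rfl fun w _ => ?_
    by_cases h : p w = p v
    · simp [h]
    · simp [h, Ne.symm h]
  have hq' : ∑ w, (if q v ≠ q w then adjInd G v w else 0) = deg G v - degIn G p i v := by
    rw [deg_eq_sum, degIn_eq_sum, ← Finset.sum_sub_distrib]
    refine Finset.sum_congr rfl fun w _ => ?_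
    by_cases hw : w = v
    · subst hw; simp [hloop]
    · rw [hqv, hqw w hw]
      by_cases h : p w = i
      · simp [h]
      · simp [h, Ne.symm h]
  rw [hrest, hp, hq'] at hle
  linarith

lemma sum_sum_ne_le {n r : ℕ} (hr : 2 ≤ r) (p : Fin n → Fin r) :
    ∑ u, ∑ w, (if p u ≠ p w then (1 : ℝ) else 0) ≤ (1 - 1 / (r : ℝ)) * n ^ 2 := by
  have hr0 : (0 : ℝ) < r := by positivity
  have h1 : ∑ i, ∑ u, (if p u = i then (1 : ℝ) else 0) = n := by
    rw [Finset.sum_comm]; simp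
  have h2 := sq_sum_le_card_mul_sum_sq (s := (Finset.univ : Finset (Fin r)))
    (f := fun i => ∑ u, (if p u = i then (1 : ℝ) else 0))
  have h3 : ∑ i, (∑ u, (if p u = i then (1 : ℝ) else 0)) ^ 2
      = ∑ u, ∑ w, (if p u = p w then (1 : ℝ) else 0) := by
    simp_rw [sq, Finset.sum_mul_sum]
    rw [Finset.sum_comm]
    refine Finset.sum_congr rfl fun u _ => ?_
    rw [Finset.sum_comm]
    refine Finset.sum_congr rfl fun w _ => ?_
    simp [eq_comm]
  rw [h1, h3, Finset.card_univ, Fintype.card_fin] at h2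
  have h4 : ∑ u, ∑ w, (if p u ≠ p w then (1 : ℝ) else 0)
      = n ^ 2 - ∑ u, ∑ w, (if p u = p w then (1 : ℝ) else 0) := by
    have : ∑ _u : Fin n, ∑ _w : Fin n, (1 : ℝ) = n ^ 2 := by simp; ring
    rw [← this, ← Finset.sum_sub_distrib]
    refine Finset.sum_congr rfl fun u _ => ?_
    rw [← Finset.sum_sub_distrib]
    refine Finset.sum_congr rfl fun w _ => ?_
    by_cases h : p u = p w <;> simp [h]
  have h5 : (n : ℝ) ^ 2 / r ≤ ∑ u, ∑ w, (if p u = p w then (1 : ℝ) else 0) := by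
    rw [div_le_iff₀ hr0]; linarith
  rw [h4]
  have h6 : (1 - 1 / (r : ℝ)) * n ^ 2 = n ^ 2 - n ^ 2 / r := by ring
  linarith

/-- Few pairs of vertices in distinct parts are non-adjacent. -/
lemma sum_missing_le {n r : ℕ} (hr : 2 ≤ r) {G : SimpleGraph (Fin n)} {p : Fin n → Fin r}
    {ε : ℝ} (hin : (∑ i : Fin r, (inCnt G p i : ℝ)) ≤ ε * n ^ 2)
    (hE : (1 - 1 / (r : ℝ) - ε) * n ^ 2 ≤ 2 * (eCnt G : ℝ)) :
    ∑ u, ∑ w, (if p u ≠ p w then 1 - adjInd G u w else 0) ≤ 3 * ε * n ^ 2 := by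
  have h1 := two_mul_eCnt_eq_cross_add_in G p
  have h2 := two_mul_crossCnt G p
  have h3 := sum_sum_ne_le hr p
  have h4 : ∑ u, ∑ w, (if p u ≠ p w then 1 - adjInd G u w else 0)
      = ∑ u, ∑ w, (if p u ≠ p w then (1 : ℝ) else 0)
        - ∑ u, ∑ w, (if p u ≠ p w then adjInd G u w else 0) := by
    rw [← Finset.sum_sub_distrib]
    refine Finset.sum_congr rfl fun u _ => ?_
    rw [← Finset.sum_sub_distrib]
    refine Finset.sum_congr rfl fun w _ => ?_
    by_cases h : p u = p w <;> simp [h]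
  have h5 : ∑ u, ∑ w, (if p u ≠ p w then adjInd G u w else 0) = 2 * (crossCnt G p : ℝ) := by
    rw [h2]
  rw [h4, h5]
  linarith

/-- The Turán graph together with all edges at the vertex `0`. -/
def turanStar (m r : ℕ) : SimpleGraph (Fin m) where
  Adj k l := (k : ℕ) % r ≠ l % r ∨ (k ≠ l ∧ ((k : ℕ) = 0 ∨ (l : ℕ) = 0))
  symm := ⟨fun k l h => by
    rcases h with h | ⟨h, h'⟩
    · exact Or.inl h.symm
    · exact Or.inr ⟨h.symm, h'.symm⟩⟩
  loopless := ⟨fun k h => by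
    rcases h with h | ⟨h, -⟩ <;> exact h rfl⟩

lemma contains_turanStar {U : Type*} {r a m : ℕ} (hr : 2 ≤ r) {F : SimpleGraph U}
    (hm : exNum m F = eCnt (turanGraph m r) + a) (hmr : r * (2 * a + 3) ≤ m) :
    Contains F (turanStar m r) := by
  by_contra hcon
  have hle : eCnt (turanStar m r) ≤ exNum m F := FFree.eCnt_le_exNum hcon
  rw [hm] at hle
  have hleR : (eCnt (turanStar m r) : ℝ) ≤ eCnt (turanGraph m r) + a := by exact_mod_cast hle
  have hm0 : 0 < m := lt_of_lt_of_le (by positivity) hmr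
  have hmono : ∀ u w, adjInd (turanGraph m r) u w ≤ adjInd (turanStar m r) u w := by
    intro u w
    by_cases h : (turanGraph m r).Adj u w
    · have h' : (turanStar m r).Adj u w := Or.inl h
      simp [adjInd, h, h']
    · simp only [adjInd, h, if_false]
      exact adjInd_nonneg _ _ _
  let z : Fin m := ⟨0, hm0⟩
  have hlt : ∀ k : Fin (2 * a + 2), r * ((k : ℕ) + 1) < m := fun k =>
    lt_of_lt_of_le (Nat.mul_lt_mul_of_pos_left (by omega) (by omega)) hmr
  let f : Fin (2 * a + 2) ↪ Fin m :=
    ⟨fun k => ⟨r * ((k : ℕ) + 1), hlt k⟩, fun k l hkl => by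
      have h1 : r * ((k : ℕ) + 1) = r * ((l : ℕ) + 1) := congrArg Fin.val hkl
      have h2 := Nat.eq_of_mul_eq_mul_left (by omega) h1
      exact Fin.ext (by omega)⟩
  have hrow : (2 * (a : ℝ) + 2) ≤
      ∑ w, (adjInd (turanStar m r) z w - adjInd (turanGraph m r) z w) := by
    calc (2 * (a : ℝ) + 2) = ∑ w ∈ Finset.univ.map f, (1 : ℝ) := by simp
      _ = ∑ w ∈ Finset.univ.map f,
          (adjInd (turanStar m r) z w - adjInd (turanGraph m r) z w) := by
        refine Finset.sum_congr rfl fun w hw => ?_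
        obtain ⟨k, -, rfl⟩ := Finset.mem_map.1 hw
        have h1 : ¬ (turanGraph m r).Adj z (f k) := by
          rw [turanGraph_adj, not_not]
          change 0 % r = r * ((k : ℕ) + 1) % r
          simp
        have h2 : (turanStar m r).Adj z (f k) := by
          refine Or.inr ⟨fun h => ?_, Or.inl rfl⟩
          have h3 : 0 = r * ((k : ℕ) + 1) := congrArg Fin.val h
          have : 0 < r * ((k : ℕ) + 1) := by positivity
          omega
        simp [adjInd, h1, h2]
      _ ≤ _ := Finset.sum_le_sum_of_subset_of_nonneg (Finset.subset_univ _)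
          fun w _ _ => sub_nonneg.2 (hmono z w)
  have hall : ∑ w, (adjInd (turanStar m r) z w - adjInd (turanGraph m r) z w) ≤
      ∑ u, ∑ w, (adjInd (turanStar m r) u w - adjInd (turanGraph m r) u w) :=
    Finset.single_le_sum
      (f := fun u => ∑ w, (adjInd (turanStar m r) u w - adjInd (turanGraph m r) u w))
      (fun u _ => Finset.sum_nonneg fun w _ => sub_nonneg.2 (hmono u w)) (Finset.mem_univ z)
  simp_rw [Finset.sum_sub_distrib] at hall hrow
  rw [← two_mul_eCnt, ← two_mul_eCnt] at hall
  linarith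

/-- If `v` has many neighbours in every part of `p` and few pairs between distinct parts are
non-adjacent, then `G` contains a Turán graph together with all edges at one vertex. -/
lemma contains_turanStar_of_large_degIn {n r m : ℕ} (hr : 2 ≤ r) {G : SimpleGraph (Fin n)}
    {p : Fin n → Fin r} {v : Fin n} {D M : ℝ} (hD : 0 < D)
    (hdeg : ∀ i, D ≤ degIn G p i v)
    (hM : ∑ u, ∑ w, (if p u ≠ p w then 1 - adjInd G u w else 0) ≤ M)
    (hsmall : (m : ℝ) ^ 2 * (1 / D + M / D ^ 2) < 1) : Contains (turanStar m r) G := by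
  classical
  by_contra hcon
  have hr0 : 0 < r := by omega
  let c : Fin m → Fin r := fun k => ⟨k % r, Nat.mod_lt _ hr0⟩
  let N : Fin r → Finset (Fin n) := fun i => Finset.univ.filter fun w => G.Adj v w ∧ p w = i
  have hN : ∀ i, D ≤ (N i).card := by
    intro i
    have : degIn G p i v = (N i).card := by
      rw [degIn, Nat.card_eq_fintype_card, Fintype.card_subtype]
    rw [← this]; exact hdeg i
  have hN0 : ∀ i, (0 : ℝ) < (N i).card := fun i => hD.trans_le (hN i)
  let y : Fin m → Fin n → ℝ := fun k u => if u ∈ N (c k) then 1 / ((N (c k)).card : ℝ) else 0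
  have hy0 : ∀ k u, 0 ≤ y k u := fun k u => by simp only [y]; positivity
  have hy1 : ∀ k, ∑ u, y k u = 1 := by
    intro k
    simp only [y, Finset.sum_ite_mem, Finset.univ_inter, Finset.sum_const, nsmul_eq_mul]
    exact mul_one_div_cancel (hN0 _).ne'
  have hyD : ∀ k u, y k u ≤ 1 / D := by
    intro k u
    simp only [y]
    split_ifs
    · exact one_div_le_one_div_of_le hD (hN _)
    · positivity
  let g : Fin m → Fin m → Fin n → Fin n → ℝ := fun k l u w =>
    if c k = c l then (if u = w then 1 else 0) else 1 - adjInd G u w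
  have hg0 : ∀ k l u w, 0 ≤ g k l u w := by
    intro k l u w
    have := adjInd_le_one G u w
    simp only [g]
    split_ifs <;> linarith
  have hM0 : 0 ≤ M := le_trans (Finset.sum_nonneg fun u _ => Finset.sum_nonneg fun w _ => by
    have := adjInd_le_one G u w
    split_ifs <;> linarith) hM
  have key := le_sum_pair_expectation y hy0 hy1 g 1 ?_
  · have hbound : ∀ k l, ∑ u, ∑ w, y k u * y l w * g k l u w ≤ 1 / D + M / D ^ 2 := by
      intro k l
      by_cases hkl : c k = c l
      · have h1 : ∑ u, ∑ w, y k u * y l w * g k l u w = ∑ u, y k u * y l u := by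
          refine Finset.sum_congr rfl fun u _ => ?_
          simp [g, hkl]
        have h2 : ∑ u, y k u * y l u ≤ ∑ u, y k u * (1 / D) :=
          Finset.sum_le_sum fun u _ => mul_le_mul_of_nonneg_left (hyD l u) (hy0 k u)
        rw [← Finset.sum_mul, hy1, one_mul] at h2
        have h3 : 0 ≤ M / D ^ 2 := by positivity
        linarith
      · have h1 : ∑ u, ∑ w, y k u * y l w * g k l u w ≤
            ∑ u, ∑ w, 1 / D ^ 2 * (if p u ≠ p w then 1 - adjInd G u w else 0) := by
          refine Finset.sum_le_sum fun u _ => Finset.sum_le_sum fun w _ => ?_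
          have hA : 0 ≤ 1 - adjInd G u w := sub_nonneg.2 (adjInd_le_one G u w)
          by_cases hu : u ∈ N (c k)
          · by_cases hw : w ∈ N (c l)
            · have hpu := (Finset.mem_filter.1 hu).2.2
              have hpw := (Finset.mem_filter.1 hw).2.2
              have hne : p u ≠ p w := by rw [hpu, hpw]; exact hkl
              simp only [g, hkl, if_false, hne, ne_eq, not_false_eq_true, if_true]
              refine mul_le_mul_of_nonneg_right ?_ hA
              calc y k u * y l w ≤ 1 / D * (1 / D) :=
                    mul_le_mul (hyD k u) (hyD l w) (hy0 l w) (by positivity)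
                _ = 1 / D ^ 2 := by ring
            · have : y l w = 0 := by simp [y, hw]
              rw [this, mul_zero, zero_mul]
              positivity
          · have : y k u = 0 := by simp [y, hu]
            rw [this, zero_mul, zero_mul]
            positivity
        simp_rw [← Finset.mul_sum] at h1
        have h2 : 1 / D ^ 2 * ∑ u, ∑ w, (if p u ≠ p w then 1 - adjInd G u w else 0)
            ≤ 1 / D ^ 2 * M := by gcongr
        have h3 : 1 / D ^ 2 * M = M / D ^ 2 := by ring
        have h4 : 0 ≤ 1 / D := by positivity
        linarith
    have htot : ∑ k, ∑ l ∈ Finset.univ.erase k, ∑ u, ∑ w, y k u * y l w * g k l u w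
        ≤ (m : ℝ) ^ 2 * (1 / D + M / D ^ 2) := by
      calc _ ≤ ∑ k : Fin m, ∑ l : Fin m, (1 / D + M / D ^ 2) :=
            Finset.sum_le_sum fun k _ => (Finset.sum_le_sum fun l _ => hbound k l).trans
              (Finset.sum_le_sum_of_subset_of_nonneg (Finset.erase_subset _ _)
                fun _ _ _ => by positivity)
        _ = _ := by simp; ring
    linarith
  · intro s hs
    by_contra! hlt
    refine hcon ?_
    have hterm : ∀ k l, k ≠ l → g k l (s k) (s l) < 1 := by
      intro k l hkl
      refine lt_of_le_of_lt ?_ hlt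
      calc g k l (s k) (s l) ≤ ∑ l ∈ Finset.univ.erase k, g k l (s k) (s l) :=
            Finset.single_le_sum (f := fun l => g k l (s k) (s l)) (fun _ _ => hg0 _ _ _ _)
              (by simp [hkl.symm])
        _ ≤ _ := Finset.single_le_sum
              (f := fun k => ∑ l ∈ Finset.univ.erase k, g k l (s k) (s l))
              (fun _ _ => Finset.sum_nonneg fun _ _ => hg0 _ _ _ _) (Finset.mem_univ k)
    have hadj : ∀ k l, c k ≠ c l → G.Adj (s k) (s l) := by
      intro k l hkl
      have h1 := hterm k l fun h => hkl (by rw [h])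
      by_contra hna
      simp [g, hkl, adjInd, hna] at h1
    have hne : ∀ k l, k ≠ l → s k ≠ s l := by
      intro k l hkl
      by_cases hc : c k = c l
      · intro h
        have h1 := hterm k l hkl
        simp [g, hc, h] at h1
      · exact (hadj k l hc).ne
    have hv : ∀ k, G.Adj v (s k) := by
      intro k
      by_contra hna
      exact hs k (by simp [y, N, hna])
    let φ : Fin m → Fin n := fun k => if (k : ℕ) = 0 then v else s k
    refine ⟨⟨φ, ?_⟩, ?_⟩
    · intro k l hkl
      by_cases hk : (k : ℕ) = 0
      · have hl : (l : ℕ) ≠ 0 := fun hl => hkl.ne (Fin.ext (hk.trans hl.symm))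
        simpa [φ, hk, hl] using hv l
      · by_cases hl : (l : ℕ) = 0
        · simpa [φ, hk, hl] using (hv k).symm
        · have h1 : (k : ℕ) % r ≠ l % r := by
            rcases hkl with h | ⟨-, h | h⟩
            · exact h
            · exact absurd h hk
            · exact absurd h hl
          have h2 : c k ≠ c l := fun h => h1 (congrArg Fin.val h)
          simpa [φ, hk, hl] using hadj k l h2
    · intro k l hkl
      by_contra hne'
      change φ k = φ l at hkl
      by_cases hk : (k : ℕ) = 0
      · have hl : (l : ℕ) ≠ 0 := fun hl => hne' (Fin.ext (hk.trans hl.symm))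
        simp only [φ, hk, hl, if_true, if_false] at hkl
        exact (hv l).ne hkl
      · by_cases hl : (l : ℕ) = 0
        · simp only [φ, hk, hl, if_true, if_false] at hkl
          exact (hv k).ne hkl.symm
        · simp only [φ, hk, hl, if_false] at hkl
          exact hne k l hne' hkl

/-- No vertex has many neighbours in its own part. -/
lemma Wset_eq_empty {U : Type*} {r a m : ℕ} (hr : 2 ≤ r) {F : SimpleGraph U}
    (hm : exNum m F = eCnt (turanGraph m r) + a) (hmr : r * (2 * a + 3) ≤ m) {θ ε : ℝ}
    (hθ : 0 < θ) (hθm : (m : ℝ) ^ 2 * θ < 1) (hε : 2 * ε < θ ^ 3) {n : ℕ}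
    (hn : (m : ℝ) ^ 2 < θ * n) {G : SimpleGraph (Fin n)} (hG : FFree F G) {p : Fin n → Fin r}
    (hp : GoodPartition r G ε p) (hE : (1 - 1 / (r : ℝ) - ε) * n ^ 2 ≤ 2 * (eCnt G : ℝ)) :
    Wset G p θ = ∅ := by
  rw [Set.eq_empty_iff_forall_notMem]
  intro v hv
  have hv' : 2 * θ * n ≤ (degIn G p (p v) v : ℝ) := hv
  have hn0 : (0 : ℝ) < n := by
    have : (0 : ℝ) ≤ (m : ℝ) ^ 2 := by positivity
    exact pos_of_mul_pos_right (by linarith) hθ.le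
  have hD : 0 < 2 * θ * n := by positivity
  have hsmall : (m : ℝ) ^ 2 * (1 / (2 * θ * n) + 3 * ε * n ^ 2 / (2 * θ * n) ^ 2) < 1 := by
    have h1 : (m : ℝ) ^ 2 * (1 / (2 * θ * n)) < 1 / 2 := by
      rw [mul_one_div, div_lt_iff₀ hD]
      linarith
    have h2 : 3 * ε * n ^ 2 / (2 * θ * n) ^ 2 ≤ 3 / 8 * θ := by
      rw [div_le_iff₀ (by positivity)]
      have : 2 * ε * n ^ 2 ≤ θ ^ 3 * n ^ 2 := by gcongr
      nlinarith
    have h3 : (m : ℝ) ^ 2 * (3 * ε * n ^ 2 / (2 * θ * n) ^ 2) ≤ m ^ 2 * (3 / 8 * θ) := by gcongr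
    rw [mul_add]
    linarith
  obtain ⟨f, hf⟩ := contains_turanStar_of_large_degIn hr hD
    (fun i => hv'.trans (degIn_own_le hp.1 v i)) (sum_missing_le hr hp.2.1 hE) hsmall
  exact hG ((contains_turanStar hr hm hmr).trans f hf)

theorem stmt_9 {W : Type*} (r a : ℕ) (hr : 2 ≤ r) (F : SimpleGraph W) (h : HypStar r a F) :
    ∃ ℓ₀ : ℕ, ∀ ℓ ≥ ℓ₀, ∀ θ ε : ℝ, 0 < θ → 0 < ε →
      θ < 1 / (100 * r ^ 5 * ℓ) → 2 * ε < θ ^ 3 →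
      ∃ n₀ : ℕ, ∀ n ≥ n₀, ∀ G : SimpleGraph (Fin n), SpecExtremal F G →
        ∀ p : Fin n → Fin r, GoodPartition r G ε p →
          (Nat.card ↥(Lset r G ε) : ℝ) ≤ ε ^ ((1 : ℝ) / 3) * n ∧
          Wset G p θ ⊆ Lset r G ε := by
  obtain ⟨m₀, hm₀⟩ := id h
  set m : ℕ := max m₀ (r * (2 * a + 3)) with hm
  refine ⟨m ^ 2 + 1, fun ℓ hℓ θ ε hθ hε hθℓ hεθ => ?_⟩
  have hℓR : (m : ℝ) ^ 2 + 1 ≤ ℓ := by exact_mod_cast hℓ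
  have hm2 : (0 : ℝ) ≤ (m : ℝ) ^ 2 := by positivity
  have hr5 : (1 : ℝ) ≤ (r : ℝ) ^ 5 := one_le_pow₀ (by exact_mod_cast (by omega : 1 ≤ r))
  have hℓ0 : (0 : ℝ) < ℓ := by linarith
  have hθ1 : θ * (100 * ℓ) < 1 := by
    rw [lt_div_iff₀ (by positivity)] at hθℓ
    refine lt_of_le_of_lt ?_ hθℓ
    gcongr
    linarith
  have hθm : (m : ℝ) ^ 2 * θ < 1 := by nlinarith
  have hθ100 : θ < 1 / 100 := by nlinarith
  have hε8 : ε ≤ 1 / 8 := by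
    have : θ ^ 3 ≤ (1 / 100) ^ 3 := by gcongr
    linarith
  set δ : ℝ := ε ^ ((1 : ℝ) / 3) with hδ
  have hδ0 : 0 < δ := by positivity
  have hδ3 : δ ^ 3 = ε := by
    rw [hδ, ← Real.rpow_natCast, ← Real.rpow_mul hε.le]
    norm_num
  have hδ2 : δ ≤ 1 / 2 := by
    by_contra! hcon
    have : (1 / 2 : ℝ) ^ 3 < δ ^ 3 := by gcongr
    linarith
  obtain ⟨n₁, hn₁⟩ := SpecExtremal.le_two_mul_eCnt hr h (η := ε / 3) (by positivity) (by linarith)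
  obtain ⟨n₂, hn₂⟩ := card_Lset_le hr h hδ0 hδ2 hδ3
  obtain ⟨n₃, hn₃⟩ := exists_nat_gt ((m : ℝ) ^ 2 / θ)
  refine ⟨n₁ + n₂ + n₃, fun n hn G hG p hp => ?_⟩
  have hE : (1 - 1 / (r : ℝ) - ε) * n ^ 2 ≤ 2 * (eCnt G : ℝ) := by
    have := hn₁ n (by omega) G hG
    rwa [mul_div_cancel₀ ε (by norm_num : (3 : ℝ) ≠ 0)] at this
  refine ⟨hn₂ n (by omega) G hG.1 hE, ?_⟩
  have hn3 : (m : ℝ) ^ 2 < θ * n := by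
    rw [div_lt_iff₀' hθ] at hn₃
    have : (n₃ : ℝ) ≤ n := by exact_mod_cast (by omega : n₃ ≤ n)
    exact hn₃.trans_le (by gcongr)
  rw [Wset_eq_empty hr (hm₀ m (le_max_left _ _)).1 (le_max_right _ _) hθ hθm hεθ hn3 hG.1 hp hE]
  exact Set.empty_subset _
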